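/- Consider a DMC W with finite input alphabet X containing the 'off' symbol 0 and finite output alphabet Y, with Q0 = W(·|0) and supp(Q0) = Y. Suppose that 0 is not redundant (Q0 is not in the convex hull of {W(·|x) : x ≠ 0}) and that X contains at least one input symbol other than 0. Then L is positive and finite, and L = max over distributions P̃ on X with P̃(0) = 0 of the quantity [ Σ_{x∈X} P̃(x) D(W(·|x) ‖ Q0) ] / √( (1/2) Σ_{y∈Y} (Q̃(y) − Q0(y))² / Q0(y) ), where Q̃ = P̃W is the output distribution induced by P̃ through W. -/

import Mathlib

open Filter
open scoped BigOperators Topology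

/-- `p` is a probability mass function on a finite type. -/
def IsDist {α : Type*} [Fintype α] (p : α → ℝ) : Prop :=
  (∀ a, 0 ≤ p a) ∧ ∑ a, p a = 1

/-- Relative entropy (in nats) between pmfs on a finite type. -/
noncomputable def relEnt {α : Type*} [Fintype α] (p q : α → ℝ) : ℝ :=
  ∑ a, p a * Real.log (p a / q a)

/-- Output distribution on `Y` induced by input distribution `P` through channel `W`. -/
noncomputable def outDist {X Y : Type*} [Fintype X] (P : X → ℝ) (W : X → Y → ℝ) : Y → ℝ :=
  fun y => ∑ x, P x * W x y

/-- Mutual information `I(P, W)`. -/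
noncomputable def mutInfo {X Y : Type*} [Fintype X] [Fintype Y] (P : X → ℝ) (W : X → Y → ℝ) : ℝ :=
  ∑ x, ∑ y, P x * W x y * Real.log (W x y / outDist P W y)

/-- The output distribution on `Y^n` induced by a random code (a distribution `ρ` over
encoder/decoder pairs) together with a uniformly chosen message, through `n` memoryless
uses of the channel `W`. -/
noncomputable def codeOut {X Y : Type*} [Fintype X] [Fintype Y] [DecidableEq Y]
    (W : X → Y → ℝ) {n m : ℕ}
    (ρ : (Fin m → Fin n → X) × ((Fin n → Y) → Fin m) → ℝ) : (Fin n → Y) → ℝ :=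
  fun ys => ∑ c, ρ c * ((m : ℝ)⁻¹ * ∑ j, ∏ i, W (c.1 j i) (ys i))

/-- Average probability of a decoding error of a random code, the message being uniform. -/
noncomputable def codeErr {X Y : Type*} [Fintype X] [Fintype Y] [DecidableEq Y]
    (W : X → Y → ℝ) {n m : ℕ}
    (ρ : (Fin m → Fin n → X) × ((Fin n → Y) → Fin m) → ℝ) : ℝ :=
  ∑ c, ρ c * ((m : ℝ)⁻¹ * ∑ j, ∑ ys : Fin n → Y,
    if c.2 ys = j then 0 else ∏ i, W (c.1 j i) (ys i))

/-- `Kmax W x0 δ ε n` is the maximum of `log |M|` (in nats) over random codes of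
blocklength `n` whose induced output distribution `Q^n` satisfies
`D(Q^n ‖ Q0^{×n}) ≤ δ` (with `Q0 = W(·|x0)`) and whose average error probability
is at most `ε`. -/
noncomputable def Kmax {X Y : Type*} [Fintype X] [Fintype Y] [DecidableEq Y]
    (W : X → Y → ℝ) (x0 : X) (δ ε : ℝ) (n : ℕ) : ℝ :=
  sSup {k : ℝ | ∃ m : ℕ, 0 < m ∧
    ∃ ρ : (Fin m → Fin n → X) × ((Fin n → Y) → Fin m) → ℝ,
      (∀ c, 0 ≤ ρ c) ∧ (∑ c, ρ c) = 1 ∧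
      relEnt (codeOut W ρ) (fun ys : Fin n → Y => ∏ i, W x0 (ys i)) ≤ δ ∧
      codeErr W ρ ≤ ε ∧ k = Real.log m}

/-- `IsL W x0 δ L` says that `L = lim_{ε↓0} liminf_{n→∞} K_n(δ,ε)/√(nδ)`
(as an extended real, so that `L = ⊤` is allowed). -/
noncomputable def IsL {X Y : Type*} [Fintype X] [Fintype Y] [DecidableEq Y]
    (W : X → Y → ℝ) (x0 : X) (δ : ℝ) (L : EReal) : Prop :=
  Tendsto (fun ε : ℝ =>
      liminf (fun n : ℕ => ((Kmax W x0 δ ε n / Real.sqrt (n * δ) : ℝ) : EReal)) atTop)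
    (nhdsWithin 0 (Set.Ioi 0)) (nhds L)

section ProductSums

variable {ι κ : Type*} [Fintype ι] [DecidableEq ι] [Fintype κ]

theorem sum_pi_prod_mul_apply (μ : ι → κ → ℝ) (hμ : ∀ i, ∑ a, μ i a = 1) (j : ι) (φ : κ → ℝ) :
    ∑ x : ι → κ, (∏ i, μ i (x i)) * φ (x j) = ∑ a, μ j a * φ a := by
  have h1 : ∀ x : ι → κ, (∏ i, μ i (x i)) * φ (x j)
      = ∏ i, μ i (x i) * (if i = j then φ (x i) else 1) := by
    intro x
    rw [Finset.prod_mul_distrib, Finset.prod_ite_eq' Finset.univ j (fun i => φ (x i))]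
    simp
  have h2 : ∀ i, ∑ a, μ i a * (if i = j then φ a else 1)
      = if i = j then ∑ a, μ i a * φ a else 1 := by
    intro i
    split_ifs <;> simp [hμ]
  simp_rw [h1]
  rw [← Fintype.prod_sum (fun i a => μ i a * (if i = j then φ a else 1))]
  simp_rw [h2]
  simp

theorem sum_pi_prod_mul_apply_mul_apply (μ : ι → κ → ℝ) (hμ : ∀ i, ∑ a, μ i a = 1)
    {j k : ι} (hjk : j ≠ k) (φ ψ : κ → ℝ) :
    ∑ x : ι → κ, (∏ i, μ i (x i)) * (φ (x j) * ψ (x k))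
      = (∑ a, μ j a * φ a) * ∑ a, μ k a * ψ a := by
  have h1 : ∀ x : ι → κ, (∏ i, μ i (x i)) * (φ (x j) * ψ (x k))
      = ∏ i, μ i (x i) * ((if i = j then φ (x i) else 1) * (if i = k then ψ (x i) else 1)) := by
    intro x
    rw [Finset.prod_mul_distrib, Finset.prod_mul_distrib,
      Finset.prod_ite_eq' Finset.univ j (fun i => φ (x i)),
      Finset.prod_ite_eq' Finset.univ k (fun i => ψ (x i))]
    simp
  have h2 : ∀ i, ∑ a, μ i a * ((if i = j then φ a else 1) * (if i = k then ψ a else 1))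
      = (if i = j then ∑ a, μ i a * φ a else 1) * (if i = k then ∑ a, μ i a * ψ a else 1) := by
    intro i
    by_cases hj : i = j
    · have hk : i ≠ k := fun h => hjk (hj.symm.trans h)
      simp [hj, hjk]
    · by_cases hk : i = k <;> simp [hj, hk, hμ, Ne.symm hjk]
  simp_rw [h1]
  rw [← Fintype.prod_sum (fun i a => μ i a *
    ((if i = j then φ a else 1) * (if i = k then ψ a else 1)))]
  simp_rw [h2]
  rw [Finset.prod_mul_distrib]
  simp

theorem isDist_pi_prod {μ : ι → κ → ℝ} (hμ : ∀ i, IsDist (μ i)) :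
    IsDist (fun x : ι → κ => ∏ i, μ i (x i)) := by
  refine ⟨fun x => Finset.prod_nonneg fun i _ => (hμ i).1 _, ?_⟩
  rw [← Fintype.prod_sum μ]
  simp [fun i => (hμ i).2]

theorem relEnt_pi_prod {μ : ι → κ → ℝ} (hμ : ∀ i, IsDist (μ i)) {q : κ → ℝ} (hq : ∀ a, 0 < q a) :
    relEnt (fun x : ι → κ => ∏ i, μ i (x i)) (fun x => ∏ i, q (x i)) = ∑ i, relEnt (μ i) q := by
  have h1 : ∀ x : ι → κ, (∏ i, μ i (x i)) * Real.log ((∏ i, μ i (x i)) / ∏ i, q (x i))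
      = ∑ j, (∏ i, μ i (x i)) * Real.log (μ j (x j) / q (x j)) := by
    intro x
    rw [← Finset.mul_sum]
    by_cases h0 : ∏ i, μ i (x i) = 0
    · simp [h0]
    · rw [← Finset.prod_div_distrib, Real.log_prod]
      intro i _
      exact div_ne_zero (Finset.prod_ne_zero_iff.1 h0 i (Finset.mem_univ _)) (hq _).ne'
  unfold relEnt
  simp_rw [h1]
  rw [Finset.sum_comm]
  exact Finset.sum_congr rfl fun j _ =>
    sum_pi_prod_mul_apply μ (fun i => (hμ i).2) j fun a => Real.log (μ j a / q a)

end ProductSums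

section RelativeEntropy

variable {α : Type*} [Fintype α]

/-- The easy half of the Donsker–Varadhan variational formula. -/
theorem sum_mul_le_relEnt_add_log {p q : α → ℝ} (hp : IsDist p) (hq : ∀ a, 0 < q a) (h : α → ℝ) :
    ∑ a, p a * h a ≤ relEnt p q + Real.log (∑ a, q a * Real.exp (h a)) := by
  set Z := ∑ a, q a * Real.exp (h a) with hZ
  have hne : Nonempty α := by
    by_contra hempty
    rw [not_nonempty_iff] at hempty
    simpa using hp.2
  have hZpos : 0 < Z :=
    Finset.sum_pos (fun a _ => mul_pos (hq a) (Real.exp_pos _)) Finset.univ_nonempty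
  have key : ∀ a, p a * h a - p a * Real.log (p a / q a) - p a * Real.log Z
      ≤ q a * Real.exp (h a) / Z - p a := by
    intro a
    have hqe := mul_pos (hq a) (Real.exp_pos (h a))
    rcases (hp.1 a).eq_or_lt with h0 | hpos
    · rw [← h0]
      simpa using (div_pos hqe hZpos).le
    · have h1 := Real.log_le_sub_one_of_pos (div_pos (div_pos hqe hZpos) hpos)
      rw [Real.log_div (div_pos hqe hZpos).ne' hpos.ne', Real.log_div hqe.ne' hZpos.ne',
        Real.log_mul (hq a).ne' (Real.exp_pos _).ne', Real.log_exp] at h1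
      rw [Real.log_div hpos.ne' (hq a).ne']
      have h2 := mul_le_mul_of_nonneg_left h1 hpos.le
      have h3 : p a * (q a * Real.exp (h a) / Z / p a - 1) = q a * Real.exp (h a) / Z - p a := by
        field_simp
      linarith
  have hsum := Finset.sum_le_sum fun a (_ : a ∈ Finset.univ) => key a
  simp only [Finset.sum_sub_distrib, ← Finset.sum_mul, ← Finset.sum_div, hp.2] at hsum
  rw [← hZ, div_self hZpos.ne'] at hsum
  unfold relEnt
  linarith

theorem relEnt_nonneg {p q : α → ℝ} (hp : IsDist p) (hq : IsDist q) (hq0 : ∀ a, 0 < q a) :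
    0 ≤ relEnt p q := by
  simpa [hq.2] using sum_mul_le_relEnt_add_log hp hq0 0

theorem relEnt_pos {p q : α → ℝ} (hp : IsDist p) (hq : IsDist q) (hq0 : ∀ a, 0 < q a)
    (hne : p ≠ q) : 0 < relEnt p q := by
  obtain ⟨b, hb⟩ := Function.ne_iff.1 hne
  have key : ∀ a, p a - q a ≤ p a * Real.log (p a / q a) ∧
      (p a ≠ q a → p a - q a < p a * Real.log (p a / q a)) := by
    intro a
    rcases (hp.1 a).eq_or_lt with h0 | hpos
    · rw [← h0]
      have := hq0 a
      simp [this, this.le]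
    · have h3 : p a * (q a / p a - 1) = q a - p a := by field_simp
      rw [← inv_div, Real.log_inv]
      constructor
      · have h1 := Real.log_le_sub_one_of_pos (div_pos (hq0 a) hpos)
        have h2 := mul_le_mul_of_nonneg_left h1 hpos.le
        linarith
      · intro hab
        have h1 := Real.log_lt_sub_one_of_pos (div_pos (hq0 a) hpos)
          (by rw [Ne, div_eq_one_iff_eq hpos.ne']; exact hab.symm)
        have h2 := mul_lt_mul_of_pos_left h1 hpos
        linarith
  have h := Finset.sum_lt_sum (fun a (_ : a ∈ Finset.univ) => (key a).1)
    ⟨b, Finset.mem_univ _, (key b).2 hb⟩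
  rw [Finset.sum_sub_distrib, hp.2, hq.2, sub_self] at h
  exact h

end RelativeEntropy

theorem exp_le_one_add_add_sq_add_cube {u : ℝ} (hu : |u| ≤ 1) :
    Real.exp u ≤ 1 + u + u ^ 2 / 2 + |u| ^ 3 := by
  have h := (abs_le.1 (Real.exp_bound hu (n := 3) (by norm_num))).2
  norm_num [Finset.sum_range_succ, Nat.factorial] at h
  nlinarith [pow_nonneg (abs_nonneg u) 3]

theorem one_add_mul_log_le {u : ℝ} (hu : |u| ≤ 1 / 2) :
    (1 + u) * Real.log (1 + u) ≤ u + u ^ 2 / 2 + 4 * |u| ^ 3 := by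
  have h := (abs_le.1 (Real.abs_log_sub_add_sum_range_le (x := -u)
    (by rw [abs_neg]; linarith) 2)).2
  norm_num [Finset.sum_range_succ] at h
  have h2 : |u| ^ 3 / (1 - |u|) ≤ 2 * |u| ^ 3 := by
    rw [div_le_iff₀ (by linarith)]
    nlinarith [pow_nonneg (abs_nonneg u) 3]
  have hl := abs_le.1 hu
  have h3 : Real.log (1 + u) ≤ u - u ^ 2 / 2 + 2 * |u| ^ 3 := by linarith
  have h4 := mul_le_mul_of_nonneg_left h3 (show 0 ≤ 1 + u by linarith)
  have h5 : -u ^ 3 ≤ |u| ^ 3 := by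
    rw [← abs_pow]; exact neg_le_abs _
  nlinarith [pow_nonneg (abs_nonneg u) 3]

/-- Converse for one deterministic code: `(1 - e) log m` is at most the average relative entropy
from the off output, up to one nat. -/
theorem log_mul_one_sub_le {X Y : Type*} [Fintype Y] {W : X → Y → ℝ} {x0 : X} (hW : ∀ x, IsDist (W x))
    (hsupp : ∀ y, 0 < W x0 y) {n m : ℕ} (hm : 0 < m) (f : Fin m → Fin n → X)
    (g : (Fin n → Y) → Fin m) :
    Real.log m * (1 - (m : ℝ)⁻¹ * ∑ j, ∑ ys : Fin n → Y,
        if g ys = j then 0 else ∏ i, W (f j i) (ys i))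
      ≤ (m : ℝ)⁻¹ * (∑ j, ∑ i, relEnt (W (f j i)) (W x0)) + 1 := by
  have hm' : (0 : ℝ) < m := by exact_mod_cast hm
  set q : (Fin n → Y) → ℝ := fun ys => ∏ i, W x0 (ys i) with hq
  have hqd : IsDist q := isDist_pi_prod fun _ => hW x0
  have hq0 : ∀ ys, 0 < q ys := fun ys => Finset.prod_pos fun i _ => hsupp _
  have hj : ∀ j, Real.log m * (1 - ∑ ys : Fin n → Y,
        if g ys = j then 0 else ∏ i, W (f j i) (ys i))
      ≤ (∑ i, relEnt (W (f j i)) (W x0)) + (m - 1) * ∑ ys, if g ys = j then q ys else 0 := by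
    intro j
    have hp : IsDist (fun ys : Fin n → Y => ∏ i, W (f j i) (ys i)) :=
      isDist_pi_prod fun i => hW (f j i)
    have h1 := sum_mul_le_relEnt_add_log hp hq0 (fun ys => if g ys = j then Real.log m else 0)
    rw [relEnt_pi_prod (fun i => hW (f j i)) hsupp] at h1
    have h2 : ∑ ys : Fin n → Y, (∏ i, W (f j i) (ys i)) * (if g ys = j then Real.log m else 0)
        = Real.log m * (1 - ∑ ys : Fin n → Y,
        if g ys = j then 0 else ∏ i, W (f j i) (ys i)) := by
      rw [← hp.2, ← Finset.sum_sub_distrib, Finset.mul_sum]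
      refine Finset.sum_congr rfl fun ys _ => ?_
      split_ifs <;> ring
    have h3 : ∑ ys, q ys * Real.exp (if g ys = j then Real.log m else 0)
        = 1 + (m - 1) * ∑ ys, if g ys = j then q ys else 0 := by
      nth_rewrite 1 [← hqd.2]
      rw [Finset.mul_sum, ← Finset.sum_add_distrib]
      refine Finset.sum_congr rfl fun ys _ => ?_
      split_ifs
      · rw [Real.exp_log hm']; ring
      · simp
    have h4 : 0 < 1 + ((m : ℝ) - 1) * ∑ ys, if g ys = j then q ys else 0 := by
      have h5 : (0 : ℝ) ≤ m - 1 := by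
        have : (1 : ℝ) ≤ m := by exact_mod_cast hm
        linarith
      have h6 : 0 ≤ ∑ ys, if g ys = j then q ys else 0 :=
        Finset.sum_nonneg fun ys _ => by split_ifs; exacts [(hq0 ys).le, le_rfl]
      positivity
    rw [h2, h3] at h1
    linarith [Real.log_le_sub_one_of_pos h4]
  have hsum := Finset.sum_le_sum fun j (_ : j ∈ Finset.univ) => hj j
  have hone : ∑ j, ∑ ys, (if g ys = j then q ys else 0) = 1 := by
    rw [Finset.sum_comm, ← hqd.2]
    exact Finset.sum_congr rfl fun ys _ => by simp
  rw [← Finset.mul_sum, Finset.sum_sub_distrib, Finset.sum_add_distrib, ← Finset.mul_sum, hone,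
    Finset.sum_const, Finset.card_univ, Fintype.card_fin, nsmul_eq_mul, mul_one, mul_one] at hsum
  have h := mul_le_mul_of_nonneg_left hsum (inv_nonneg.2 hm'.le)
  have e1 : ∀ E : ℝ, (m : ℝ)⁻¹ * (Real.log m * (m - E)) = Real.log m * (1 - (m : ℝ)⁻¹ * E) := by
    intro E; field_simp
  have e2 : ∀ E : ℝ, (m : ℝ)⁻¹ * (E + (m - 1)) = (m : ℝ)⁻¹ * E + 1 - (m : ℝ)⁻¹ := by
    intro E; field_simp
    ring
  rw [e1, e2] at h
  linarith [inv_pos.2 hm']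

section Converse

variable {X Y : Type*} [Fintype X] [Fintype Y] [DecidableEq Y]

theorem sum_codeOut_mul (W : X → Y → ℝ) {n m : ℕ}
    (ρ : (Fin m → Fin n → X) × ((Fin n → Y) → Fin m) → ℝ) (F : (Fin n → Y) → ℝ) :
    ∑ ys, codeOut W ρ ys * F ys
      = ∑ c, ρ c * ((m : ℝ)⁻¹ * ∑ j, ∑ ys : Fin n → Y, (∏ i, W (c.1 j i) (ys i)) * F ys) := by
  unfold codeOut
  simp_rw [Finset.sum_mul]
  rw [Finset.sum_comm]
  refine Finset.sum_congr rfl fun c _ => ?_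
  rw [Finset.sum_comm (s := (Finset.univ : Finset (Fin m)))]
  simp_rw [mul_assoc, ← Finset.mul_sum, Finset.sum_mul]

theorem isDist_codeOut {W : X → Y → ℝ} (hW : ∀ x, IsDist (W x)) {n m : ℕ} (hm : 0 < m)
    {ρ : (Fin m → Fin n → X) × ((Fin n → Y) → Fin m) → ℝ} (hρ : IsDist ρ) :
    IsDist (codeOut W ρ) := by
  have hm' : (m : ℝ) ≠ 0 := by positivity
  constructor
  · intro ys
    exact Finset.sum_nonneg fun c _ => mul_nonneg (hρ.1 c) (mul_nonneg (by positivity)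
      (Finset.sum_nonneg fun j _ => Finset.prod_nonneg fun i _ => (hW _).1 _))
  · have h := sum_codeOut_mul W ρ 1
    simp only [Pi.one_apply, mul_one] at h
    rw [h]
    have h2 : ∀ c : (Fin m → Fin n → X) × ((Fin n → Y) → Fin m), ∀ j,
        ∑ ys : Fin n → Y, ∏ i, W (c.1 j i) (ys i) = 1 :=
      fun c j => (isDist_pi_prod fun i => hW (c.1 j i)).2
    simp_rw [h2]
    simp [hm', hρ.2]

/-- The expected number of uses `A x` of each input symbol controls both the size of the code
and its detectability. -/
theorem exists_occupation {W : X → Y → ℝ} {x0 : X} (hW : ∀ x, IsDist (W x))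
    (hsupp : ∀ y, 0 < W x0 y) {n m : ℕ} (hm : 0 < m)
    {ρ : (Fin m → Fin n → X) × ((Fin n → Y) → Fin m) → ℝ} (hρ : IsDist ρ) :
    ∃ A : X → ℝ, (∀ x, 0 ≤ A x) ∧
      Real.log m * (1 - codeErr W ρ) ≤ (∑ x, A x * relEnt (W x) (W x0)) + 1 ∧
      ∀ h : Y → ℝ, ∑ x, A x * ∑ y, W x y * h y
        ≤ relEnt (codeOut W ρ) (fun ys : Fin n → Y => ∏ i, W x0 (ys i))
          + n * Real.log (∑ y, W x0 y * Real.exp (h y)) := by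
  classical
  set A : X → ℝ := fun x =>
    ∑ c, ρ c * ((m : ℝ)⁻¹ * ∑ j, ∑ i, if c.1 j i = x then 1 else 0) with hA
  have hAsum : ∀ φ : X → ℝ,
      ∑ x, A x * φ x = ∑ c, ρ c * ((m : ℝ)⁻¹ * ∑ j, ∑ i, φ (c.1 j i)) := by
    intro φ
    simp only [hA, Finset.sum_mul]
    rw [Finset.sum_comm]
    refine Finset.sum_congr rfl fun c _ => ?_
    simp_rw [mul_assoc, ← Finset.mul_sum, Finset.sum_mul]
    rw [Finset.sum_comm]
    congr 2
    refine Finset.sum_congr rfl fun j _ => ?_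
    rw [Finset.sum_comm]
    refine Finset.sum_congr rfl fun i _ => ?_
    simp
  refine ⟨A, ?_, ?_, ?_⟩
  · intro x
    exact Finset.sum_nonneg fun c _ => mul_nonneg (hρ.1 c) (mul_nonneg (by positivity)
      (Finset.sum_nonneg fun j _ => Finset.sum_nonneg fun i _ => by split_ifs <;> norm_num))
  · rw [hAsum fun x => relEnt (W x) (W x0)]
    have h := Finset.sum_le_sum fun c (_ : c ∈ Finset.univ) =>
      mul_le_mul_of_nonneg_left (log_mul_one_sub_le hW hsupp hm c.1 c.2) (hρ.1 c)
    simp only [mul_add, mul_one, Finset.sum_add_distrib, hρ.2] at h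
    refine le_trans (le_of_eq ?_) h
    unfold codeErr
    simp only [mul_sub, mul_one, Finset.sum_sub_distrib, ← Finset.sum_mul, hρ.2, one_mul,
      Finset.mul_sum (a := Real.log m)]
    congr 1
    exact Finset.sum_congr rfl fun c _ => by rw [mul_left_comm, Finset.mul_sum]
  · intro h
    rw [hAsum fun x => ∑ y, W x y * h y]
    have hdv := sum_mul_le_relEnt_add_log (isDist_codeOut hW hm hρ)
      (q := fun ys : Fin n → Y => ∏ i, W x0 (ys i))
      (fun ys => Finset.prod_pos fun i _ => hsupp _) (fun ys => ∑ i, h (ys i))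
    rw [sum_codeOut_mul] at hdv
    have e1 : ∀ (c : (Fin m → Fin n → X) × ((Fin n → Y) → Fin m)) (j : Fin m),
        ∑ ys : Fin n → Y, (∏ i, W (c.1 j i) (ys i)) * ∑ i, h (ys i)
          = ∑ i, ∑ y, W (c.1 j i) y * h y := by
      intro c j
      simp_rw [Finset.mul_sum]
      rw [Finset.sum_comm]
      exact Finset.sum_congr rfl fun i _ =>
        sum_pi_prod_mul_apply (fun i => W (c.1 j i)) (fun i => (hW _).2) i h
    have e2 : ∑ ys : Fin n → Y, (∏ i, W x0 (ys i)) * Real.exp (∑ i, h (ys i))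
        = (∑ y, W x0 y * Real.exp (h y)) ^ n := by
      simp_rw [Real.exp_sum, ← Finset.prod_mul_distrib]
      rw [← Fintype.prod_sum (fun (_ : Fin n) y => W x0 y * Real.exp (h y))]
      simp
    simp_rw [e1] at hdv
    rwa [e2, Real.log_pow] at hdv

end Converse

/-- Half the chi-square distance from the off output of the output induced by `P`. -/
noncomputable def halfChiSq {X Y : Type*} [Fintype X] [Fintype Y] (W : X → Y → ℝ) (x0 : X)
    (P : X → ℝ) : ℝ :=
  2⁻¹ * ∑ y, (outDist P W y - W x0 y) ^ 2 / W x0 y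

/-- The relative deviation of the output induced by `P` from the off output. -/
noncomputable def relDev {X Y : Type*} [Fintype X] (W : X → Y → ℝ) (x0 : X) (P : X → ℝ) : Y → ℝ :=
  fun y => (outDist P W y - W x0 y) / W x0 y

theorem mul_relDev {X Y : Type*} [Fintype X] {W : X → Y → ℝ} {x0 : X} {P : X → ℝ}
    (hsupp : ∀ y, 0 < W x0 y) (y : Y) :
    W x0 y * relDev W x0 P y = outDist P W y - W x0 y := by
  unfold relDev
  field_simp [(hsupp y).ne']

section SingleLetter

variable {X Y : Type*} [Fintype X] [Fintype Y] {W : X → Y → ℝ} {x0 : X} {P : X → ℝ}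

theorem isDist_outDist (hW : ∀ x, IsDist (W x)) (hP : IsDist P) : IsDist (outDist P W) := by
  constructor
  · exact fun y => Finset.sum_nonneg fun x _ => mul_nonneg (hP.1 x) ((hW x).1 y)
  · unfold outDist
    rw [Finset.sum_comm]
    simp_rw [← Finset.mul_sum, (hW _).2, mul_one, hP.2]

theorem IsDist.le_one {α : Type*} [Fintype α] {p : α → ℝ} (hp : IsDist p) (a : α) : p a ≤ 1 := by
  rw [← hp.2]
  exact Finset.single_le_sum (fun b _ => hp.1 b) (Finset.mem_univ a)

theorem sum_mul_relDev (hW : ∀ x, IsDist (W x)) (hsupp : ∀ y, 0 < W x0 y) (hP : IsDist P) :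
    ∑ y, W x0 y * relDev W x0 P y = 0 := by
  simp_rw [mul_relDev hsupp, Finset.sum_sub_distrib, (isDist_outDist hW hP).2, (hW x0).2, sub_self]

theorem sum_mul_relDev_sq (hsupp : ∀ y, 0 < W x0 y) :
    ∑ y, W x0 y * relDev W x0 P y ^ 2 = 2 * halfChiSq W x0 P := by
  unfold halfChiSq
  rw [mul_inv_cancel_left₀ two_ne_zero]
  refine Finset.sum_congr rfl fun y _ => ?_
  unfold relDev
  field_simp [(hsupp y).ne']

theorem sum_outDist_mul_relDev (hW : ∀ x, IsDist (W x)) (hsupp : ∀ y, 0 < W x0 y)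
    (hP : IsDist P) :
    ∑ y, outDist P W y * relDev W x0 P y = 2 * halfChiSq W x0 P := by
  rw [← sum_mul_relDev_sq hsupp, ← add_zero (∑ y, W x0 y * relDev W x0 P y ^ 2),
    ← sum_mul_relDev hW hsupp hP, ← Finset.sum_add_distrib]
  refine Finset.sum_congr rfl fun y _ => ?_
  rw [show outDist P W y = W x0 y * relDev W x0 P y + W x0 y by rw [mul_relDev hsupp]; ring]
  ring

theorem abs_relDev_le (hW : ∀ x, IsDist (W x)) (hsupp : ∀ y, 0 < W x0 y) (hP : IsDist P) (y : Y) :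
    |relDev W x0 P y| ≤ ∑ y, (W x0 y)⁻¹ := by
  have h1 : |outDist P W y - W x0 y| ≤ 1 := by
    have hQ := isDist_outDist hW hP
    rw [abs_le]
    constructor <;> linarith [hQ.1 y, hQ.le_one y, (hW x0).1 y, (hW x0).le_one y]
  have h2 : (W x0 y)⁻¹ ≤ ∑ y, (W x0 y)⁻¹ :=
    Finset.single_le_sum (fun b _ => (inv_pos.2 (hsupp b)).le) (Finset.mem_univ y)
  unfold relDev
  rw [abs_div, abs_of_pos (hsupp y), div_eq_mul_inv]
  have := inv_pos.2 (hsupp y)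
  nlinarith

/-- Second-order expansion of an expectation under the off output. -/
theorem sum_mul_comp_relDev_le (hW : ∀ x, IsDist (W x)) (hsupp : ∀ y, 0 < W x0 y) (hP : IsDist P)
    {s r C : ℝ} (hs : 0 ≤ s) (hC : 0 ≤ C) (hsr : s * ∑ y, (W x0 y)⁻¹ ≤ r) {a : ℝ} {F : ℝ → ℝ}
    (hF : ∀ u, |u| ≤ r → F u ≤ a + u + u ^ 2 / 2 + C * |u| ^ 3) :
    ∑ y, W x0 y * F (s * relDev W x0 P y)
      ≤ a + s ^ 2 * halfChiSq W x0 P + C * (s * ∑ y, (W x0 y)⁻¹) ^ 3 := by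
  set τ := ∑ y, (W x0 y)⁻¹
  have h1 : ∀ y, W x0 y * F (s * relDev W x0 P y)
      ≤ W x0 y * (a + C * (s * τ) ^ 3) + s * (W x0 y * relDev W x0 P y)
        + s ^ 2 / 2 * (W x0 y * relDev W x0 P y ^ 2) := by
    intro y
    have hu : |s * relDev W x0 P y| ≤ s * τ := by
      rw [abs_mul, abs_of_nonneg hs]
      exact mul_le_mul_of_nonneg_left (abs_relDev_le hW hsupp hP y) hs
    have h2 : |s * relDev W x0 P y| ^ 3 ≤ (s * τ) ^ 3 := pow_le_pow_left₀ (abs_nonneg _) hu 3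
    have h3 := mul_le_mul_of_nonneg_left ((hF _ (hu.trans hsr)).trans
      (add_le_add_right (mul_le_mul_of_nonneg_left h2 hC) _)) (hsupp y).le
    refine h3.trans (le_of_eq ?_)
    ring
  refine (Finset.sum_le_sum fun y _ => h1 y).trans (le_of_eq ?_)
  rw [Finset.sum_add_distrib, Finset.sum_add_distrib, ← Finset.sum_mul, ← Finset.mul_sum,
    ← Finset.mul_sum, (hW x0).2, sum_mul_relDev hW hsupp hP, sum_mul_relDev_sq hsupp]
  ring

theorem log_sum_exp_relDev_le (hW : ∀ x, IsDist (W x)) (hsupp : ∀ y, 0 < W x0 y) (hP : IsDist P)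
    {s : ℝ} (hs : 0 ≤ s) (hs1 : s * ∑ y, (W x0 y)⁻¹ ≤ 1) :
    Real.log (∑ y, W x0 y * Real.exp (s * relDev W x0 P y))
      ≤ s ^ 2 * halfChiSq W x0 P + (s * ∑ y, (W x0 y)⁻¹) ^ 3 := by
  have h := sum_mul_comp_relDev_le hW hsupp hP hs zero_le_one hs1 (a := 1) (F := Real.exp)
    fun u hu => by simpa using exp_le_one_add_add_sq_add_cube hu
  have hne : (Finset.univ : Finset Y).Nonempty := by
    by_contra h0
    simpa [Finset.not_nonempty_iff_eq_empty.1 h0] using (hW x0).2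
  have hpos : 0 < ∑ y, W x0 y * Real.exp (s * relDev W x0 P y) :=
    Finset.sum_pos (fun y _ => mul_pos (hsupp y) (Real.exp_pos _)) hne
  linarith [Real.log_le_sub_one_of_pos hpos]

theorem relEnt_le_of_eq_one_add_relDev (hW : ∀ x, IsDist (W x)) (hsupp : ∀ y, 0 < W x0 y)
    (hP : IsDist P) {s : ℝ} (hs : 0 ≤ s) (hs1 : s * ∑ y, (W x0 y)⁻¹ ≤ 1 / 2) {Q : Y → ℝ}
    (hQ : ∀ y, Q y = W x0 y * (1 + s * relDev W x0 P y)) :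
    relEnt Q (W x0) ≤ s ^ 2 * halfChiSq W x0 P + 4 * (s * ∑ y, (W x0 y)⁻¹) ^ 3 := by
  have h := sum_mul_comp_relDev_le hW hsupp hP hs zero_le_four hs1 (a := 0)
    (F := fun u => (1 + u) * Real.log (1 + u))
    fun u hu => by simpa using one_add_mul_log_le hu
  rw [zero_add] at h
  refine le_trans (le_of_eq ?_) h
  refine Finset.sum_congr rfl fun y _ => ?_
  rw [hQ, mul_div_cancel_left₀ _ (hsupp y).ne', mul_assoc]

/-- Single-letter converse for occupation measures. -/
theorem sum_mul_relEnt_le (hW : ∀ x, IsDist (W x)) (hsupp : ∀ y, 0 < W x0 y)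
    {Lr c δ : ℝ} (hLr : 0 ≤ Lr) (hc : 0 < c) (hδ : 0 < δ)
    (hmin : ∀ P : X → ℝ, IsDist P → P x0 = 0 → c ≤ halfChiSq W x0 P)
    (hrate : ∀ P : X → ℝ, IsDist P → P x0 = 0 →
      ∑ x, P x * relEnt (W x) (W x0) ≤ Lr * Real.sqrt (halfChiSq W x0 P))
    {n : ℕ} (hn0 : 0 < n) (hn : δ * (∑ y, (W x0 y)⁻¹) ^ 2 ≤ n * c) {A : X → ℝ}
    (hA : ∀ x, 0 ≤ A x)
    (hdet : ∀ h : Y → ℝ, ∑ x, A x * ∑ y, W x y * h y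
        ≤ δ + n * Real.log (∑ y, W x0 y * Real.exp (h y))) :
    ∑ x, A x * relEnt (W x) (W x0) ≤
      Lr * (Real.sqrt (n * δ) + (∑ y, (W x0 y)⁻¹) ^ 3 * δ / (2 * c * Real.sqrt c)) := by
  classical
  set τ := ∑ y, (W x0 y)⁻¹ with hτ
  have hτ0 : 0 ≤ τ := Finset.sum_nonneg fun y _ => (inv_pos.2 (hsupp y)).le
  have hn' : (0 : ℝ) < n := by exact_mod_cast hn0
  have hD0 : relEnt (W x0) (W x0) = 0 := by
    unfold relEnt
    exact Finset.sum_eq_zero fun y _ => by rw [div_self (hsupp y).ne', Real.log_one, mul_zero]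
  set β := ∑ x ∈ Finset.univ.erase x0, A x with hβ
  have hsplit : ∀ φ : X → ℝ, ∑ x, A x * φ x
      = A x0 * φ x0 + ∑ x ∈ Finset.univ.erase x0, A x * φ x :=
    fun φ => (Finset.add_sum_erase _ _ (Finset.mem_univ x0)).symm
  have hβ0 : 0 ≤ β := Finset.sum_nonneg fun x _ => hA x
  rcases hβ0.eq_or_lt with h0 | hβpos
  · have hz := (Finset.sum_eq_zero_iff_of_nonneg fun x _ => hA x).1 h0.symm
    rw [hsplit, hD0, Finset.sum_eq_zero fun x hx => by rw [hz x hx, zero_mul]]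
    simp only [mul_zero, add_zero]
    positivity
  set P : X → ℝ := fun x => if x = x0 then 0 else A x / β with hPdef
  have hPsum : ∀ φ : X → ℝ, ∑ x ∈ Finset.univ.erase x0, A x * φ x = β * ∑ x, P x * φ x := by
    intro φ
    rw [← Finset.add_sum_erase Finset.univ (fun x => P x * φ x) (Finset.mem_univ x0)]
    have hP0 : P x0 = 0 := by simp [hPdef]
    rw [hP0, zero_mul, zero_add, Finset.mul_sum]
    refine Finset.sum_congr rfl fun x hx => ?_
    simp only [hPdef, if_neg (Finset.ne_of_mem_erase hx)]
    field_simp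
  have hP0 : P x0 = 0 := by simp [hPdef]
  have hP : IsDist P := by
    constructor
    · intro x
      simp only [hPdef]
      split_ifs
      exacts [le_rfl, div_nonneg (hA x) hβ0]
    · have h := hPsum 1
      simp only [Pi.one_apply, mul_one] at h
      exact (mul_left_cancel₀ hβpos.ne' (by rw [mul_one]; exact h)).symm
  set χ := halfChiSq W x0 P with hχ
  have hcχ : c ≤ χ := hmin P hP hP0
  have hχ0 : 0 < χ := hc.trans_le hcχ
  set s := Real.sqrt (δ / (n * χ)) with hs
  have hs0 : 0 < s := Real.sqrt_pos.2 (by positivity)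
  have hs2 : s ^ 2 * (n * χ) = δ := by
    rw [hs, Real.sq_sqrt (by positivity)]
    field_simp
  have hs1 : s * τ ≤ 1 := by
    have h1 : (s * τ) ^ 2 * (n * χ) ≤ 1 * (n * χ) := by
      calc (s * τ) ^ 2 * (n * χ) = δ * τ ^ 2 := by rw [← hs2]; ring
        _ ≤ n * c := hn
        _ ≤ 1 * (n * χ) := by rw [one_mul]; exact mul_le_mul_of_nonneg_left hcχ hn'.le
    have h2 := le_of_mul_le_mul_right h1 (by positivity)
    exact (sq_le_one_iff₀ (by positivity)).1 h2
  have h1 := hdet fun y => s * relDev W x0 P y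
  have h2 := log_sum_exp_relDev_le hW hsupp hP hs0.le hs1
  have h3 : ∑ x, A x * ∑ y, W x y * (s * relDev W x0 P y) = 2 * s * β * χ := by
    rw [hsplit, hPsum]
    have e1 : ∑ y, W x0 y * (s * relDev W x0 P y) = 0 := by
      simp_rw [mul_left_comm _ s, ← Finset.mul_sum, sum_mul_relDev hW hsupp hP, mul_zero]
    have e2 : ∑ x, P x * ∑ y, W x y * (s * relDev W x0 P y)
        = s * ∑ y, outDist P W y * relDev W x0 P y := by
      unfold outDist
      simp_rw [Finset.mul_sum, Finset.sum_mul, Finset.mul_sum]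
      rw [Finset.sum_comm]
      exact Finset.sum_congr rfl fun y _ => Finset.sum_congr rfl fun x _ => by ring
    rw [e1, e2, sum_outDist_mul_relDev hW hsupp hP]
    ring
  rw [h3] at h1
  have h4 : 2 * s * β * χ ≤ 2 * δ + n * (s * τ) ^ 3 := by
    have := mul_le_mul_of_nonneg_left h2 hn'.le
    nlinarith
  have hsχ : s * Real.sqrt χ * Real.sqrt n = Real.sqrt δ := by
    rw [hs, ← Real.sqrt_mul (by positivity), ← Real.sqrt_mul (by positivity)]
    congr 1
    field_simp
  have hβχ : β * Real.sqrt χ ≤ Real.sqrt (n * δ) + τ ^ 3 * δ / (2 * χ * Real.sqrt χ) := by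
    have hsx : 0 < Real.sqrt χ := Real.sqrt_pos.2 hχ0
    have hsn : 0 < Real.sqrt n := Real.sqrt_pos.2 hn'
    have q1 : Real.sqrt χ ^ 2 = χ := Real.sq_sqrt hχ0.le
    have q2 : Real.sqrt n ^ 2 = n := Real.sq_sqrt hn'.le
    rw [Real.sqrt_mul hn'.le, ← hsχ]
    have h5 : 0 < 2 * s * Real.sqrt χ := by positivity
    refine le_of_mul_le_mul_left ?_ h5
    calc 2 * s * Real.sqrt χ * (β * Real.sqrt χ) = 2 * s * β * Real.sqrt χ ^ 2 := by ring
      _ = 2 * s * β * χ := by rw [q1]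
      _ ≤ 2 * δ + n * (s * τ) ^ 3 := h4
      _ = _ := by
        rw [← hs2]
        generalize Real.sqrt χ = v at *
        generalize Real.sqrt (n : ℝ) = w at *
        rw [← q1, ← q2]
        field_simp
  have hmono : τ ^ 3 * δ / (2 * χ * Real.sqrt χ) ≤ τ ^ 3 * δ / (2 * c * Real.sqrt c) := by
    have := Real.sqrt_pos.2 hc
    gcongr
  calc ∑ x, A x * relEnt (W x) (W x0) = β * ∑ x, P x * relEnt (W x) (W x0) := by
        rw [hsplit, hD0, mul_zero, zero_add, hPsum]
    _ ≤ β * (Lr * Real.sqrt χ) := mul_le_mul_of_nonneg_left (hrate P hP hP0) hβ0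
    _ = Lr * (β * Real.sqrt χ) := by ring
    _ ≤ _ := mul_le_mul_of_nonneg_left (hβχ.trans (add_le_add_right hmono _)) hLr

end SingleLetter

section RandomCoding

variable {X Y : Type*}

/-- Maximum-likelihood decoding fails only if the sent word has likelihood ratio at most `exp γ`
or another word has likelihood ratio above `exp γ`; both events are bounded by powers of the
likelihood ratio. -/
theorem likelihood_error_le [Fintype Y] {W : X → Y → ℝ} {x0 : X} (hW : ∀ x, IsDist (W x))
    (hsupp : ∀ y, 0 < W x0 y) {n m : ℕ} {lam : ℝ} (hlam : 0 ≤ lam) (γ : ℝ)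
    (f : Fin m → Fin n → X) (ys : Fin n → Y) {k : Fin m}
    (hk : ∀ j, ∏ i, W (f j i) (ys i) ≤ ∏ i, W (f k i) (ys i)) (j : Fin m) :
    (if k = j then 0 else ∏ i, W (f j i) (ys i)) ≤
      Real.exp (lam * γ) * (∏ i, W (f j i) (ys i)
        * Real.exp (-lam * Real.log (W (f j i) (ys i) / W x0 (ys i))))
      + ∑ l, if l = j then 0 else Real.exp (-γ) / (∏ i, W x0 (ys i))
          * ((∏ i, W (f j i) (ys i)) * ∏ i, W (f l i) (ys i)) := by
  have hw : ∀ l, 0 ≤ ∏ i, W (f l i) (ys i) := fun l => Finset.prod_nonneg fun i _ => (hW _).1 _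
  have hq : 0 < ∏ i, W x0 (ys i) := Finset.prod_pos fun i _ => hsupp _
  have hU : 0 ≤ Real.exp (lam * γ) * (∏ i, W (f j i) (ys i)
        * Real.exp (-lam * Real.log (W (f j i) (ys i) / W x0 (ys i)))) :=
    mul_nonneg (Real.exp_pos _).le
      (Finset.prod_nonneg fun i _ => mul_nonneg ((hW _).1 _) (Real.exp_pos _).le)
  have hV : ∀ l, 0 ≤ if l = j then 0 else Real.exp (-γ) / (∏ i, W x0 (ys i))
          * ((∏ i, W (f j i) (ys i)) * ∏ i, W (f l i) (ys i)) := by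
    intro l
    split_ifs
    · exact le_rfl
    · exact mul_nonneg (div_nonneg (Real.exp_pos _).le hq.le) (mul_nonneg (hw j) (hw l))
  have hVsum := Finset.sum_nonneg fun l (_ : l ∈ Finset.univ) => hV l
  by_cases hkj : k = j
  · rw [if_pos hkj]
    exact add_nonneg hU hVsum
  rw [if_neg hkj]
  by_cases hγ : ∏ i, W (f j i) (ys i) ≤ Real.exp γ * ∏ i, W x0 (ys i)
  · refine le_add_of_le_of_nonneg ?_ hVsum
    by_cases h0 : ∏ i, W (f j i) (ys i) = 0
    · rw [h0]; exact hU
    have hpos : 0 < ∏ i, W (f j i) (ys i) := lt_of_le_of_ne (hw j) (Ne.symm h0)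
    have hlog : ∑ i, Real.log (W (f j i) (ys i) / W x0 (ys i)) ≤ γ := by
      rw [← Real.log_prod fun i _ => div_ne_zero
        (Finset.prod_ne_zero_iff.1 h0 i (Finset.mem_univ _)) (hsupp _).ne',
        Finset.prod_div_distrib, Real.log_le_iff_le_exp (div_pos hpos hq), div_le_iff₀ hq]
      exact hγ
    rw [Finset.prod_mul_distrib, ← Real.exp_sum, ← Finset.mul_sum, mul_left_comm, ← Real.exp_add]
    refine le_mul_of_one_le_right (hw j) (Real.one_le_exp ?_)
    nlinarith
  · refine le_add_of_nonneg_of_le hU ?_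
    refine le_trans ?_ (Finset.single_le_sum (fun l _ => hV l) (Finset.mem_univ k))
    rw [if_neg hkj]
    have h1 : Real.exp γ * ∏ i, W x0 (ys i) ≤ ∏ i, W (f k i) (ys i) := (not_le.1 hγ).le.trans (hk j)
    have h2 : 1 ≤ Real.exp (-γ) / (∏ i, W x0 (ys i)) * ∏ i, W (f k i) (ys i) := by
      rw [div_mul_eq_mul_div, one_le_div hq, Real.exp_neg, inv_mul_eq_div,
        le_div_iff₀ (Real.exp_pos _), mul_comm]
      exact h1
    calc ∏ i, W (f j i) (ys i) ≤ (∏ i, W (f j i) (ys i)) *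
          (Real.exp (-γ) / (∏ i, W x0 (ys i)) * ∏ i, W (f k i) (ys i)) :=
          le_mul_of_one_le_right (hw j) h2
      _ = _ := by ring

theorem sum_pi_prod_mul_prod [Fintype X] (P : X → ℝ) (V : X → Y → ℝ) {n : ℕ} (ys : Fin n → Y) :
    ∑ x : Fin n → X, (∏ i, P (x i)) * ∏ i, V (x i) (ys i) = ∏ i, outDist P V (ys i) := by
  unfold outDist
  rw [Fintype.prod_sum (fun i a => P a * V a (ys i))]
  simp_rw [Finset.prod_mul_distrib]

/-- Random coding with i.i.d. codewords and maximum-likelihood decoding. -/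
theorem exists_random_code [Fintype X] [Fintype Y] [DecidableEq Y] {W : X → Y → ℝ} {x0 : X} (hW : ∀ x, IsDist (W x))
    (hsupp : ∀ y, 0 < W x0 y) {P : X → ℝ} (hP : IsDist P) (n : ℕ) {m : ℕ} (hm : 0 < m)
    {lam : ℝ} (hlam : 0 ≤ lam) (γ : ℝ) :
    ∃ ρ : (Fin m → Fin n → X) × ((Fin n → Y) → Fin m) → ℝ, IsDist ρ ∧
      codeOut W ρ = (fun ys => ∏ i, outDist P W (ys i)) ∧
      codeErr W ρ ≤ Real.exp (lam * γ) * (∑ x, P x * ∑ y, W x y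
          * Real.exp (-lam * Real.log (W x y / W x0 y))) ^ n
        + m * (Real.exp (-γ) * (∑ y, outDist P W y ^ 2 / W x0 y) ^ n) := by
  classical
  have hm' : (0 : ℝ) < m := by exact_mod_cast hm
  have : Nonempty (Fin m) := ⟨⟨0, hm⟩⟩
  have hg : ∀ (f : Fin m → Fin n → X) (ys : Fin n → Y),
      ∃ k : Fin m, ∀ j, ∏ i, W (f j i) (ys i) ≤ ∏ i, W (f k i) (ys i) :=
    fun f ys => Finite.exists_max fun k => ∏ i, W (f k i) (ys i)
  choose g hg using hg
  set p : (Fin n → X) → ℝ := fun x => ∏ i, P (x i) with hp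
  have hpd : IsDist p := isDist_pi_prod fun _ => hP
  have hpd' : IsDist (fun f : Fin m → Fin n → X => ∏ j, p (f j)) := isDist_pi_prod fun _ => hpd
  set ρ : (Fin m → Fin n → X) × ((Fin n → Y) → Fin m) → ℝ :=
    fun c => if c.2 = g c.1 then ∏ j, p (c.1 j) else 0 with hρ
  have hρsum : ∀ Φ : (Fin m → Fin n → X) × ((Fin n → Y) → Fin m) → ℝ,
      ∑ c, ρ c * Φ c = ∑ f, (∏ j, p (f j)) * Φ (f, g f) := by
    intro Φ
    rw [Fintype.sum_prod_type]
    refine Finset.sum_congr rfl fun f _ => ?_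
    simp [hρ]
  have hj1 : ∀ (j : Fin m) (φ : (Fin n → X) → ℝ),
      ∑ f : Fin m → Fin n → X, (∏ j, p (f j)) * φ (f j) = ∑ x, p x * φ x :=
    fun j φ => sum_pi_prod_mul_apply (fun _ => p) (fun _ => hpd.2) j φ
  have hj2 : ∀ (j l : Fin m) (φ ψ : (Fin n → X) → ℝ), j ≠ l →
      ∑ f : Fin m → Fin n → X, (∏ j, p (f j)) * (φ (f j) * ψ (f l))
        = (∑ x, p x * φ x) * ∑ x, p x * ψ x :=
    fun j l φ ψ hjl => sum_pi_prod_mul_apply_mul_apply (fun _ => p) (fun _ => hpd.2) hjl φ ψ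
  refine ⟨ρ, ⟨fun c => ?_, ?_⟩, ?_, ?_⟩
  · simp only [hρ]
    split_ifs
    exacts [hpd'.1 _, le_rfl]
  · have h := hρsum 1
    simp only [Pi.one_apply, mul_one] at h
    rw [h, hpd'.2]
  · funext ys
    unfold codeOut
    rw [hρsum fun c => (m : ℝ)⁻¹ * ∑ j, ∏ i, W (c.1 j i) (ys i)]
    simp_rw [mul_left_comm _ (m : ℝ)⁻¹, ← Finset.mul_sum,
      Finset.mul_sum (s := (Finset.univ : Finset (Fin m)))]
    rw [Finset.sum_comm]
    have h : ∀ j : Fin m, ∑ f : Fin m → Fin n → X, (∏ j, p (f j)) * ∏ i, W (f j i) (ys i)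
        = ∏ i, outDist P W (ys i) := by
      intro j
      rw [hj1 j fun x => ∏ i, W (x i) (ys i)]
      exact sum_pi_prod_mul_prod P W ys
    simp_rw [h]
    simp [hm'.ne']
  · set G := ∑ x, P x * ∑ y, W x y * Real.exp (-lam * Real.log (W x y / W x0 y)) with hG
    set H := ∑ y, outDist P W y ^ 2 / W x0 y with hH
    have hHn : ∑ ys : Fin n → Y, Real.exp (-γ) / (∏ i, W x0 (ys i))
        * ((∏ i, outDist P W (ys i)) * ∏ i, outDist P W (ys i)) = Real.exp (-γ) * H ^ n := by
      have e : ∀ ys : Fin n → Y, Real.exp (-γ) / (∏ i, W x0 (ys i))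
          * ((∏ i, outDist P W (ys i)) * ∏ i, outDist P W (ys i))
          = Real.exp (-γ) * ∏ i, outDist P W (ys i) ^ 2 / W x0 (ys i) := by
        intro ys
        rw [Finset.prod_div_distrib, Finset.prod_pow]
        ring
      simp_rw [e]
      rw [← Finset.mul_sum,
        ← Fintype.prod_sum (fun (_ : Fin n) y => outDist P W y ^ 2 / W x0 y)]
      simp [hH]
    have hGn : ∑ ys : Fin n → Y, ∑ x : Fin n → X, p x * (Real.exp (lam * γ) * (∏ i,
        W (x i) (ys i) * Real.exp (-lam * Real.log (W (x i) (ys i) / W x0 (ys i)))))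
        = Real.exp (lam * γ) * G ^ n := by
      have e : ∀ ys : Fin n → Y, ∑ x : Fin n → X, p x * (Real.exp (lam * γ) * (∏ i,
        W (x i) (ys i) * Real.exp (-lam * Real.log (W (x i) (ys i) / W x0 (ys i)))))
          = Real.exp (lam * γ) * ∏ i, outDist P
            (fun x y => W x y * Real.exp (-lam * Real.log (W x y / W x0 y))) (ys i) := by
        intro ys
        rw [← sum_pi_prod_mul_prod, Finset.mul_sum]
        exact Finset.sum_congr rfl fun x _ => mul_left_comm _ _ _
      simp_rw [e]
      rw [← Finset.mul_sum, ← Fintype.prod_sum (fun (_ : Fin n) y => outDist P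
            (fun x y => W x y * Real.exp (-lam * Real.log (W x y / W x0 y))) y)]
      have e3 : ∑ y, outDist P
            (fun x y => W x y * Real.exp (-lam * Real.log (W x y / W x0 y))) y = G := by
        unfold outDist
        rw [Finset.sum_comm]
        simp_rw [hG, ← Finset.mul_sum]
      rw [e3]
      simp
    have hHpos : 0 ≤ Real.exp (-γ) * H ^ n :=
      mul_nonneg (Real.exp_pos _).le (pow_nonneg (Finset.sum_nonneg fun y _ =>
        div_nonneg (sq_nonneg _) (hsupp y).le) _)
    have hE : ∀ j : Fin m, ∑ f : Fin m → Fin n → X, (∏ j, p (f j)) * ∑ ys : Fin n → Y,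
        (if g f ys = j then 0 else ∏ i, W (f j i) (ys i))
        ≤ Real.exp (lam * γ) * G ^ n + m * (Real.exp (-γ) * H ^ n) := by
      intro j
      have h1 := Finset.sum_le_sum fun f (_ : f ∈ (Finset.univ : Finset (Fin m → Fin n → X))) =>
        mul_le_mul_of_nonneg_left (Finset.sum_le_sum fun ys (_ : ys ∈ Finset.univ) =>
          likelihood_error_le hW hsupp hlam γ f ys (hg f ys) j) (hpd'.1 f)
      refine h1.trans ?_
      simp_rw [Finset.sum_add_distrib, mul_add, Finset.sum_add_distrib]
      refine add_le_add (le_of_eq ?_) ?_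
      · rw [← hGn]
        simp_rw [Finset.mul_sum (s := (Finset.univ : Finset (Fin n → Y)))]
        rw [Finset.sum_comm]
        exact Finset.sum_congr rfl fun ys _ => hj1 j fun x => Real.exp (lam * γ) * (∏ i,
          W (x i) (ys i) * Real.exp (-lam * Real.log (W (x i) (ys i) / W x0 (ys i))))
      · have h2 : ∀ l : Fin m, ∑ f : Fin m → Fin n → X, (∏ j, p (f j)) * ∑ ys : Fin n → Y,
            (if l = j then 0 else Real.exp (-γ) / (∏ i, W x0 (ys i))
              * ((∏ i, W (f j i) (ys i)) * ∏ i, W (f l i) (ys i)))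
            ≤ Real.exp (-γ) * H ^ n := by
          intro l
          by_cases hlj : l = j
          · simpa [hlj] using hHpos
          · simp only [if_neg hlj]
            rw [← hHn]
            simp_rw [Finset.mul_sum (s := (Finset.univ : Finset (Fin n → Y)))]
            rw [Finset.sum_comm]
            refine le_of_eq (Finset.sum_congr rfl fun ys _ => ?_)
            simp_rw [mul_left_comm _ (Real.exp (-γ) / _)]
            rw [← Finset.mul_sum, hj2 j l (fun x => ∏ i, W (x i) (ys i))
              (fun x => ∏ i, W (x i) (ys i)) (Ne.symm hlj), sum_pi_prod_mul_prod P W ys]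
        have h3 := Finset.sum_le_sum fun l (_ : l ∈ (Finset.univ : Finset (Fin m))) => h2 l
        rw [Finset.sum_const, Finset.card_univ, Fintype.card_fin, nsmul_eq_mul] at h3
        refine le_trans (le_of_eq ?_) h3
        rw [Finset.sum_comm]
        refine Finset.sum_congr rfl fun f _ => ?_
        rw [Finset.sum_comm, Finset.mul_sum]
    unfold codeErr
    rw [hρsum fun c => (m : ℝ)⁻¹ * ∑ j, ∑ ys : Fin n → Y,
      if c.2 ys = j then 0 else ∏ i, W (c.1 j i) (ys i)]
    simp_rw [mul_left_comm _ (m : ℝ)⁻¹, ← Finset.mul_sum]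
    simp_rw [Finset.mul_sum (s := (Finset.univ : Finset (Fin m)))]
    rw [Finset.sum_comm, inv_mul_le_iff₀ hm']
    refine (Finset.sum_le_sum fun j _ => hE j).trans (le_of_eq ?_)
    rw [Finset.sum_const, Finset.card_univ, Fintype.card_fin, nsmul_eq_mul]

end RandomCoding

section Achievability

variable {X Y : Type*} [Fintype X] [Fintype Y] {W : X → Y → ℝ} {x0 : X} {P : X → ℝ}

theorem exists_tilted_sum_le (hW : ∀ x, IsDist (W x)) (hP : IsDist P)
    (hN : 0 < ∑ x, P x * relEnt (W x) (W x0)) {θ : ℝ} (hθ : θ < 1) :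
    ∃ lam > 0, ∑ x, P x * ∑ y, W x y * Real.exp (-lam * Real.log (W x y / W x0 y))
      ≤ 1 - lam * θ * ∑ x, P x * relEnt (W x) (W x0) := by
  set N := ∑ x, P x * relEnt (W x) (W x0) with hNdef
  set l : X → Y → ℝ := fun x y => Real.log (W x y / W x0 y) with hl
  set T := 1 + ∑ x, ∑ y, |l x y| with hT
  set M := 1 + ∑ x, P x * ∑ y, W x y * l x y ^ 2 with hM
  have hT1 : 0 < T :=
    add_pos_of_pos_of_nonneg one_pos
      (Finset.sum_nonneg fun x _ => Finset.sum_nonneg fun y _ => abs_nonneg _)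
  have hM1 : 0 < M :=
    add_pos_of_pos_of_nonneg one_pos (Finset.sum_nonneg fun x _ => mul_nonneg (hP.1 x)
      (Finset.sum_nonneg fun y _ => mul_nonneg ((hW x).1 y) (sq_nonneg _)))
  have hlT : ∀ x y, |l x y| ≤ T := by
    intro x y
    have h1 : |l x y| ≤ ∑ y, |l x y| :=
      Finset.single_le_sum (f := fun y => |l x y|) (fun _ _ => abs_nonneg _) (Finset.mem_univ y)
    have h2 : ∑ y, |l x y| ≤ ∑ x, ∑ y, |l x y| :=
      Finset.single_le_sum (f := fun x => ∑ y, |l x y|)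
        (fun _ _ => Finset.sum_nonneg fun _ _ => abs_nonneg _) (Finset.mem_univ x)
    linarith
  have hθ' : 0 < 1 - θ := by linarith
  set lam := min T⁻¹ ((1 - θ) * N / M) with hlam
  have hlam0 : 0 < lam := lt_min (inv_pos.2 hT1) (by positivity)
  refine ⟨lam, hlam0, ?_⟩
  have h1 : ∀ x y, Real.exp (-lam * l x y) ≤ 1 - lam * l x y + lam ^ 2 * l x y ^ 2 := by
    intro x y
    have hu : |-lam * l x y| ≤ 1 := by
      rw [abs_mul, abs_neg, abs_of_pos hlam0]
      calc lam * |l x y| ≤ T⁻¹ * T :=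
            mul_le_mul (min_le_left _ _) (hlT x y) (abs_nonneg _) (inv_pos.2 hT1).le
        _ = 1 := inv_mul_cancel₀ hT1.ne'
    have h := (abs_le.1 (Real.abs_exp_sub_one_sub_id_le hu)).2
    nlinarith
  have h2 : ∑ x, P x * ∑ y, W x y * Real.exp (-lam * l x y)
      ≤ ∑ x, P x * ∑ y, W x y * (1 - lam * l x y + lam ^ 2 * l x y ^ 2) :=
    Finset.sum_le_sum fun x _ => mul_le_mul_of_nonneg_left (Finset.sum_le_sum fun y _ =>
      mul_le_mul_of_nonneg_left (h1 x y) ((hW x).1 y)) (hP.1 x)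
  have h3 : ∑ x, P x * ∑ y, W x y * (1 - lam * l x y + lam ^ 2 * l x y ^ 2)
      = 1 - lam * N + lam ^ 2 * (M - 1) := by
    have e : ∀ x, ∑ y, W x y * (1 - lam * l x y + lam ^ 2 * l x y ^ 2)
        = 1 - lam * relEnt (W x) (W x0) + lam ^ 2 * ∑ y, W x y * l x y ^ 2 := by
      intro x
      have e1 : ∀ y, W x y * (1 - lam * l x y + lam ^ 2 * l x y ^ 2)
          = W x y - lam * (W x y * l x y) + lam ^ 2 * (W x y * l x y ^ 2) := fun y => by ring
      simp_rw [e1, Finset.sum_add_distrib, Finset.sum_sub_distrib, ← Finset.mul_sum, (hW x).2]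
      rfl
    have e2 : ∀ x, P x * (1 - lam * relEnt (W x) (W x0) + lam ^ 2 * ∑ y, W x y * l x y ^ 2)
        = P x - lam * (P x * relEnt (W x) (W x0))
          + lam ^ 2 * (P x * ∑ y, W x y * l x y ^ 2) := fun x => by ring
    simp_rw [e, e2, Finset.sum_add_distrib, Finset.sum_sub_distrib, ← Finset.mul_sum, hP.2]
    rw [hM, add_sub_cancel_left]
  have h4 : lam * M ≤ (1 - θ) * N := by
    rw [← le_div_iff₀ hM1]
    exact min_le_right _ _
  have h5 : lam * (lam * M) ≤ lam * ((1 - θ) * N) := mul_le_mul_of_nonneg_left h4 hlam0.le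
  nlinarith [sq_nonneg lam]

theorem exists_good_codes [DecidableEq Y] (hW : ∀ x, IsDist (W x)) (hsupp : ∀ y, 0 < W x0 y)
    (hP : IsDist P) (hN : 0 < ∑ x, P x * relEnt (W x) (W x0)) (hχ : 0 < halfChiSq W x0 P)
    {δ ε θ : ℝ} (hδ : 0 < δ) (hε : 0 < ε) (hθ0 : 0 < θ) (hθ1 : θ < 1) :
    ∃ B : ℝ, ∀ᶠ n : ℕ in atTop, ∃ m : ℕ, 0 < m ∧
      ∃ ρ : (Fin m → Fin n → X) × ((Fin n → Y) → Fin m) → ℝ, IsDist ρ ∧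
        relEnt (codeOut W ρ) (fun ys : Fin n → Y => ∏ i, W x0 (ys i)) ≤ δ ∧
        codeErr W ρ ≤ ε ∧
        θ ^ 3 * ((∑ x, P x * relEnt (W x) (W x0)) / Real.sqrt (halfChiSq W x0 P))
          * Real.sqrt (n * δ) - B ≤ Real.log m := by
  classical
  obtain ⟨lam, hlam, hG⟩ := exists_tilted_sum_le hW hP hN hθ1
  set N := ∑ x, P x * relEnt (W x) (W x0) with hNdef
  set χ := halfChiSq W x0 P with hχdef
  set τ := ∑ y, (W x0 y)⁻¹ with hτ
  have hτ0 : 0 ≤ τ := Finset.sum_nonneg fun y _ => (inv_pos.2 (hsupp y)).le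
  set b := 2 * δ - Real.log (ε / 2) with hb
  refine ⟨b + Real.log 2, ?_⟩
  set al : ℕ → ℝ := fun n => θ * Real.sqrt (δ / χ) / Real.sqrt n with hal
  set v : ℕ → ℝ := fun n => θ * (N / Real.sqrt χ) * Real.sqrt (n * δ) with hv
  have hsqrt : Tendsto (fun n : ℕ => Real.sqrt n) atTop atTop :=
    Real.tendsto_sqrt_atTop.comp tendsto_natCast_atTop_atTop
  have hal0 : Tendsto al atTop (𝓝 0) := tendsto_const_nhds.div_atTop hsqrt
  have hsχ := Real.sqrt_pos.2 hχ
  have hv0 : Tendsto v atTop atTop := by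
    refine Tendsto.const_mul_atTop (by positivity) ?_
    exact Real.tendsto_sqrt_atTop.comp (tendsto_natCast_atTop_atTop.atTop_mul_const hδ)
  have hθ2 : 0 < 1 - θ ^ 2 := by nlinarith
  have c1 : ∀ᶠ n in atTop, al n ≤ 1 := hal0.eventually (eventually_le_nhds one_pos)
  have c2 : ∀ᶠ n in atTop, al n * τ ≤ 1 / 2 := by
    have h : Tendsto (fun n => al n * τ) atTop (𝓝 0) := by simpa using hal0.mul_const τ
    exact h.eventually (eventually_le_nhds (by norm_num))
  have c3 : ∀ᶠ n in atTop, al n * (4 * τ ^ 3 * (θ ^ 2 * δ / χ)) ≤ (1 - θ ^ 2) * δ := by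
    have h : Tendsto (fun n => al n * (4 * τ ^ 3 * (θ ^ 2 * δ / χ))) atTop (𝓝 0) := by
      simpa using hal0.mul_const (4 * τ ^ 3 * (θ ^ 2 * δ / χ))
    exact h.eventually (eventually_le_nhds (by positivity))
  have hθ3 : 0 < lam * θ * (1 - θ) := mul_pos (mul_pos hlam hθ0) (by linarith)
  have c4 : ∀ᶠ n in atTop, -Real.log (ε / 2) ≤ lam * θ * (1 - θ) * v n :=
    (hv0.const_mul_atTop hθ3).eventually_ge_atTop _
  have c5 : ∀ᶠ n in atTop, b ≤ θ ^ 2 * v n :=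
    (hv0.const_mul_atTop (by positivity)).eventually_ge_atTop _
  filter_upwards [c1, c2, c3, c4, c5, eventually_gt_atTop 0] with n c1 c2 c3 c4 c5 hn
  have hn' : (0 : ℝ) < n := by exact_mod_cast hn
  have hsn := Real.sqrt_pos.2 hn'
  have halpos : 0 ≤ al n := by simp only [hal]; positivity
  have hal2 : n * al n ^ 2 = θ ^ 2 * δ / χ := by
    simp only [hal]
    rw [div_pow, mul_pow, Real.sq_sqrt (by positivity), Real.sq_sqrt hn'.le]
    field_simp
  have hvn : v n = n * al n * N := by
    simp only [hal, hv]
    rw [Real.sqrt_mul hn'.le, Real.sqrt_div hδ.le]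
    have : Real.sqrt n * Real.sqrt n = n := Real.mul_self_sqrt hn'.le
    generalize Real.sqrt (n : ℝ) = w at *
    rw [← this]
    field_simp
  set P' : X → ℝ := fun x => (if x = x0 then 1 - al n else 0) + al n * P x with hP'
  have hP'sum : ∀ φ : X → ℝ, ∑ x, P' x * φ x = (1 - al n) * φ x0 + al n * ∑ x, P x * φ x := by
    intro φ
    simp only [hP', add_mul, Finset.sum_add_distrib, ite_mul, zero_mul, mul_assoc,
      ← Finset.mul_sum]
    simp
  have hP'd : IsDist P' := by
    constructor
    · intro x
      have h1 := mul_nonneg halpos (hP.1 x)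
      simp only [hP']
      split_ifs <;> linarith
    · have h := hP'sum 1
      simp only [Pi.one_apply, mul_one, hP.2] at h
      rw [h]; ring
  have hQ : ∀ y, outDist P' W y = W x0 y * (1 + al n * relDev W x0 P y) := by
    intro y
    have h : outDist P' W y = (1 - al n) * W x0 y + al n * outDist P W y := hP'sum fun x => W x y
    have h2 := mul_relDev (P := P) hsupp y
    rw [h]
    linear_combination -al n * h2
  set γ := θ ^ 2 * v n with hγ
  set m := ⌊Real.exp (γ - b)⌋₊ with hm
  have hexp1 : 1 ≤ Real.exp (γ - b) := Real.one_le_exp (by linarith)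
  have hm0 : 0 < m := Nat.floor_pos.2 hexp1
  have hm1 : (1 : ℝ) ≤ m := by exact_mod_cast hm0
  have hmle : (m : ℝ) ≤ Real.exp (γ - b) := Nat.floor_le (Real.exp_pos _).le
  have hmge : Real.exp (γ - b) / 2 ≤ m := by
    have := Nat.lt_floor_add_one (Real.exp (γ - b))
    linarith
  obtain ⟨ρ, hρ, hout, herr⟩ := exists_random_code hW hsupp hP'd n hm0 hlam.le γ
  refine ⟨m, hm0, ρ, hρ, ?_, ?_, ?_⟩
  · rw [hout, relEnt_pi_prod (fun _ => isDist_outDist hW hP'd) hsupp, Finset.sum_const,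
      Finset.card_univ, Fintype.card_fin, nsmul_eq_mul]
    have h := mul_le_mul_of_nonneg_left
      (relEnt_le_of_eq_one_add_relDev hW hsupp hP halpos c2 hQ) hn'.le
    refine h.trans ?_
    have e : (n : ℝ) * (al n ^ 2 * χ + 4 * (al n * τ) ^ 3)
        = n * al n ^ 2 * χ + 4 * τ ^ 3 * (n * al n ^ 2) * al n := by ring
    rw [e, hal2, div_mul_cancel₀ _ hχ.ne']
    linarith
  · refine herr.trans ?_
    have hG1 : ∑ x, P' x * ∑ y, W x y * Real.exp (-lam * Real.log (W x y / W x0 y))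
        ≤ Real.exp (-(al n * (lam * θ * N))) := by
      rw [hP'sum fun x => ∑ y, W x y * Real.exp (-lam * Real.log (W x y / W x0 y))]
      have e : ∑ y, W x0 y * Real.exp (-lam * Real.log (W x0 y / W x0 y)) = 1 := by
        rw [← (hW x0).2]
        refine Finset.sum_congr rfl fun y _ => ?_
        rw [div_self (hsupp y).ne', Real.log_one, mul_zero, Real.exp_zero, mul_one]
      rw [e]
      have h1 := mul_le_mul_of_nonneg_left hG halpos
      have h2 := Real.add_one_le_exp (-(al n * (lam * θ * N)))
      linarith
    have hG0 : 0 ≤ ∑ x, P' x * ∑ y, W x y * Real.exp (-lam * Real.log (W x y / W x0 y)) :=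
      Finset.sum_nonneg fun x _ => mul_nonneg (hP'd.1 x) (Finset.sum_nonneg fun y _ =>
        mul_nonneg ((hW x).1 y) (Real.exp_pos _).le)
    have hGn : Real.exp (lam * γ) * (∑ x, P' x * ∑ y, W x y
        * Real.exp (-lam * Real.log (W x y / W x0 y))) ^ n ≤ ε / 2 := by
      calc _ ≤ Real.exp (lam * γ) * Real.exp (-(al n * (lam * θ * N))) ^ n :=
            mul_le_mul_of_nonneg_left (pow_le_pow_left₀ hG0 hG1 n) (Real.exp_pos _).le
        _ = Real.exp (-(lam * θ * (1 - θ) * v n)) := by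
            rw [← Real.exp_nat_mul, ← Real.exp_add, hγ]
            congr 1
            rw [hvn]
            ring
        _ ≤ Real.exp (Real.log (ε / 2)) := Real.exp_le_exp.2 (by linarith)
        _ = ε / 2 := Real.exp_log (by positivity)
    have hH1 : ∑ y, outDist P' W y ^ 2 / W x0 y ≤ Real.exp (al n ^ 2 * (2 * χ)) := by
      have e : ∑ y, outDist P' W y ^ 2 / W x0 y = 1 + al n ^ 2 * (2 * χ) := by
        have e1 : ∀ y, outDist P' W y ^ 2 / W x0 y = W x0 y + 2 * al n *
            (W x0 y * relDev W x0 P y) + al n ^ 2 * (W x0 y * relDev W x0 P y ^ 2) := by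
          intro y
          have := (hsupp y).ne'
          rw [hQ]
          field_simp
          ring
        simp_rw [e1, Finset.sum_add_distrib, ← Finset.mul_sum]
        rw [sum_mul_relDev hW hsupp hP, sum_mul_relDev_sq hsupp, (hW x0).2]
        ring
      rw [e, add_comm]
      exact Real.add_one_le_exp _
    have hH0 : 0 ≤ ∑ y, outDist P' W y ^ 2 / W x0 y :=
      Finset.sum_nonneg fun y _ => div_nonneg (sq_nonneg _) (hsupp y).le
    have hHn : m * (Real.exp (-γ) * (∑ y, outDist P' W y ^ 2 / W x0 y) ^ n) ≤ ε / 2 := by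
      calc _ ≤ Real.exp (γ - b) * (Real.exp (-γ) * Real.exp (al n ^ 2 * (2 * χ)) ^ n) := by
            gcongr
        _ = Real.exp (2 * (n * al n ^ 2 * χ) - b) := by
            rw [← Real.exp_nat_mul, ← Real.exp_add, ← Real.exp_add]
            congr 1
            ring
        _ ≤ Real.exp (Real.log (ε / 2)) := by
            rw [hal2, div_mul_cancel₀ _ hχ.ne', hb]
            refine Real.exp_le_exp.2 ?_
            nlinarith
        _ = ε / 2 := Real.exp_log (by positivity)
    linarith
  · have h := Real.log_le_log (by positivity) hmge
    rw [Real.log_div (Real.exp_pos _).ne' two_ne_zero, Real.log_exp] at h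
    refine le_trans (le_of_eq ?_) h
    simp only [hγ, hv]
    ring

end Achievability

section Optimization

variable {X Y : Type*} [Fintype X] [Fintype Y] {W : X → Y → ℝ} {x0 : X}

theorem isCompact_setOf_isDist_off : IsCompact {P : X → ℝ | IsDist P ∧ P x0 = 0} := by
  have h : {P : X → ℝ | IsDist P ∧ P x0 = 0} = stdSimplex ℝ X ∩ {P | P x0 = 0} := rfl
  rw [h]
  exact (isCompact_stdSimplex ℝ X).inter_right (isClosed_eq (continuous_apply x0) continuous_const)

theorem continuous_halfChiSq : Continuous (halfChiSq W x0) := by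
  unfold halfChiSq outDist
  fun_prop

theorem halfChiSq_pos (hsupp : ∀ y, 0 < W x0 y)
    (hnotred : W x0 ∉ convexHull ℝ (W '' {x : X | x ≠ x0})) {P : X → ℝ} (hP : IsDist P)
    (hP0 : P x0 = 0) : 0 < halfChiSq W x0 P := by
  classical
  have hnn : ∀ y ∈ (Finset.univ : Finset Y), 0 ≤ (outDist P W y - W x0 y) ^ 2 / W x0 y :=
    fun y _ => div_nonneg (sq_nonneg _) (hsupp y).le
  refine mul_pos (by norm_num) ((Finset.sum_nonneg hnn).lt_of_ne fun h0 => hnotred ?_)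
  have hz := (Finset.sum_eq_zero_iff_of_nonneg hnn).1 h0.symm
  have hsum : ∀ φ : X → ℝ, ∑ x ∈ Finset.univ.erase x0, P x * φ x = ∑ x, P x * φ x := by
    intro φ
    rw [← Finset.add_sum_erase Finset.univ (fun x => P x * φ x) (Finset.mem_univ x0), hP0,
      zero_mul, zero_add]
  have heq : ∑ x ∈ Finset.univ.erase x0, P x • W x = W x0 := by
    funext y
    have h1 := hz y (Finset.mem_univ y)
    rw [div_eq_zero_iff, or_iff_left (hsupp y).ne', sq_eq_zero_iff, sub_eq_zero] at h1
    rw [← h1, Finset.sum_apply]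
    exact hsum fun x => W x y
  rw [← heq]
  refine (convex_convexHull ℝ _).sum_mem (fun x _ => hP.1 x) ?_ fun x hx =>
    subset_convexHull ℝ _ ⟨x, Finset.ne_of_mem_erase hx, rfl⟩
  simpa [hP.2] using hsum 1

end Optimization

section Capacity

variable {X Y : Type*} [Fintype X] [Fintype Y] [DecidableEq Y] {W : X → Y → ℝ} {x0 : X}

theorem exists_log_card_le (hW : ∀ x, IsDist (W x)) (hsupp : ∀ y, 0 < W x0 y)
    {Lr c δ : ℝ} (hLr : 0 ≤ Lr) (hc : 0 < c) (hδ : 0 < δ)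
    (hmin : ∀ P : X → ℝ, IsDist P → P x0 = 0 → c ≤ halfChiSq W x0 P)
    (hrate : ∀ P : X → ℝ, IsDist P → P x0 = 0 →
      ∑ x, P x * relEnt (W x) (W x0) ≤ Lr * Real.sqrt (halfChiSq W x0 P)) :
    ∃ K : ℝ, 0 ≤ K ∧ ∀ᶠ n : ℕ in atTop, ∀ m : ℕ, 0 < m →
      ∀ ρ : (Fin m → Fin n → X) × ((Fin n → Y) → Fin m) → ℝ, IsDist ρ →
        relEnt (codeOut W ρ) (fun ys : Fin n → Y => ∏ i, W x0 (ys i)) ≤ δ →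
        Real.log m * (1 - codeErr W ρ) ≤ Lr * Real.sqrt (n * δ) + K := by
  set τ := ∑ y, (W x0 y)⁻¹ with hτ
  have hτ0 : 0 ≤ τ := Finset.sum_nonneg fun y _ => (inv_pos.2 (hsupp y)).le
  refine ⟨Lr * (τ ^ 3 * δ / (2 * c * Real.sqrt c)) + 1, by positivity, ?_⟩
  have h1 : ∀ᶠ n : ℕ in atTop, δ * τ ^ 2 ≤ n * c :=
    (tendsto_natCast_atTop_atTop.atTop_mul_const hc).eventually_ge_atTop _
  filter_upwards [h1, eventually_gt_atTop 0] with n h1 hn m hm ρ hρ hdet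
  obtain ⟨A, hA, hrel, hdv⟩ := exists_occupation hW hsupp hm hρ
  have h2 := sum_mul_relEnt_le hW hsupp hLr hc hδ hmin hrate hn h1 hA
    fun h => (hdv h).trans (add_le_add_left hdet _)
  rw [← hτ] at h2
  linarith

theorem liminf_Kmax_le {Lr K δ ε : ℝ} (hLr : 0 ≤ Lr) (hK : 0 ≤ K) (hδ : 0 < δ) (hε : ε < 1)
    (h : ∀ᶠ n : ℕ in atTop, ∀ m : ℕ, 0 < m →
      ∀ ρ : (Fin m → Fin n → X) × ((Fin n → Y) → Fin m) → ℝ, IsDist ρ →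
        relEnt (codeOut W ρ) (fun ys : Fin n → Y => ∏ i, W x0 (ys i)) ≤ δ →
        Real.log m * (1 - codeErr W ρ) ≤ Lr * Real.sqrt (n * δ) + K) :
    liminf (fun n : ℕ => ((Kmax W x0 δ ε n / Real.sqrt (n * δ) : ℝ) : EReal)) atTop
      ≤ ((Lr / (1 - ε) : ℝ) : EReal) := by
  have hε' : 0 < 1 - ε := by linarith
  have hsq : Tendsto (fun n : ℕ => Real.sqrt (n * δ)) atTop atTop :=
    Real.tendsto_sqrt_atTop.comp (tendsto_natCast_atTop_atTop.atTop_mul_const hδ)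
  have hlim : Tendsto (fun n : ℕ => ((Lr + K / Real.sqrt (n * δ)) / (1 - ε) : ℝ)) atTop
      (𝓝 (Lr / (1 - ε))) := by
    have := ((tendsto_const_nhds (x := K)).div_atTop hsq).const_add Lr
    simpa using this.div_const (1 - ε)
  have hlim' := (continuous_coe_real_ereal.tendsto _).comp hlim
  rw [← hlim'.liminf_eq]
  refine liminf_le_liminf ?_
  filter_upwards [h, eventually_gt_atTop 0] with n h hn
  have hn' : (0 : ℝ) < n := by exact_mod_cast hn
  have hs : 0 < Real.sqrt (n * δ) := Real.sqrt_pos.2 (by positivity)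
  refine EReal.coe_le_coe_iff.2 ?_
  have hk : Kmax W x0 δ ε n ≤ (Lr * Real.sqrt (n * δ) + K) / (1 - ε) := by
    refine Real.sSup_le ?_ (by positivity)
    rintro k ⟨m, hm, ρ, hρ0, hρ1, hdet, herr, rfl⟩
    rw [le_div_iff₀ hε']
    exact (mul_le_mul_of_nonneg_left (by linarith) (Real.log_natCast_nonneg m)).trans
      (h m hm ρ ⟨hρ0, hρ1⟩ hdet)
  rw [div_le_iff₀ hs]
  refine hk.trans (le_of_eq ?_)
  field_simp

theorem le_liminf_Kmax {Lr K B r δ ε : ℝ} (hδ : 0 < δ) (hε : ε < 1)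
    (h : ∀ᶠ n : ℕ in atTop, ∀ m : ℕ, 0 < m →
      ∀ ρ : (Fin m → Fin n → X) × ((Fin n → Y) → Fin m) → ℝ, IsDist ρ →
        relEnt (codeOut W ρ) (fun ys : Fin n → Y => ∏ i, W x0 (ys i)) ≤ δ →
        Real.log m * (1 - codeErr W ρ) ≤ Lr * Real.sqrt (n * δ) + K)
    (hcodes : ∀ᶠ n : ℕ in atTop, ∃ m : ℕ, 0 < m ∧
      ∃ ρ : (Fin m → Fin n → X) × ((Fin n → Y) → Fin m) → ℝ, IsDist ρ ∧
        relEnt (codeOut W ρ) (fun ys : Fin n → Y => ∏ i, W x0 (ys i)) ≤ δ ∧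
        codeErr W ρ ≤ ε ∧ r * Real.sqrt (n * δ) - B ≤ Real.log m) :
    (r : EReal) ≤
      liminf (fun n : ℕ => ((Kmax W x0 δ ε n / Real.sqrt (n * δ) : ℝ) : EReal)) atTop := by
  have hε' : 0 < 1 - ε := by linarith
  have hsq : Tendsto (fun n : ℕ => Real.sqrt (n * δ)) atTop atTop :=
    Real.tendsto_sqrt_atTop.comp (tendsto_natCast_atTop_atTop.atTop_mul_const hδ)
  have hlim : Tendsto (fun n : ℕ => (r - B / Real.sqrt (n * δ) : ℝ)) atTop (𝓝 r) := by
    simpa using ((tendsto_const_nhds (x := B)).div_atTop hsq).const_sub r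
  have hlim' := (continuous_coe_real_ereal.tendsto _).comp hlim
  rw [← hlim'.liminf_eq]
  refine liminf_le_liminf ?_
  filter_upwards [h, hcodes, eventually_gt_atTop 0] with n h hcodes hn
  have hn' : (0 : ℝ) < n := by exact_mod_cast hn
  have hs : 0 < Real.sqrt (n * δ) := Real.sqrt_pos.2 (by positivity)
  refine EReal.coe_le_coe_iff.2 ?_
  obtain ⟨m, hm, ρ, hρ, hdet, herr, hlog⟩ := hcodes
  have hk : Real.log m ≤ Kmax W x0 δ ε n := by
    refine le_csSup ⟨(Lr * Real.sqrt (n * δ) + K) / (1 - ε), ?_⟩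
      ⟨m, hm, ρ, hρ.1, hρ.2, hdet, herr, rfl⟩
    rintro k ⟨m, hm, ρ, hρ0, hρ1, hdet, herr, rfl⟩
    rw [le_div_iff₀ hε']
    exact (mul_le_mul_of_nonneg_left (by linarith) (Real.log_natCast_nonneg m)).trans
      (h m hm ρ ⟨hρ0, hρ1⟩ hdet)
  rw [le_div_iff₀ hs, sub_mul, div_mul_cancel₀ _ hs.ne']
  exact hlog.trans hk

end Capacity

/-!
STATEMENT 2: For a DMC with `supp(Q0) = Y`, whose off symbol `x0` is not redundant
(`Q0` is not in the convex hull of the other output distributions), and which has at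
least one input symbol other than `x0`, `L` is positive and finite and equals
`max_{P̃ : P̃(x0)=0} [Σ_x P̃(x) D(W(·|x) ‖ Q0)] / √((1/2) Σ_y (Q̃(y)−Q0(y))²/Q0(y))`,
where `Q̃ = P̃W`.
-/

theorem statement2 {X Y : Type*} [Fintype X] [Fintype Y] [DecidableEq Y]
    (W : X → Y → ℝ) (x0 : X) (hW : ∀ x, IsDist (W x)) (hsupp : ∀ y, 0 < W x0 y)
    (hnotred : W x0 ∉ convexHull ℝ (W '' {x : X | x ≠ x0}))
    (hX : ∃ x : X, x ≠ x0)
    (δ : ℝ) (hδ : 0 < δ) (L : EReal) (hL : IsL W x0 δ L) :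
    ∃ Lr : ℝ, 0 < Lr ∧ L = (Lr : EReal) ∧
      IsGreatest {r : ℝ | ∃ P : X → ℝ, IsDist P ∧ P x0 = 0 ∧
        r = (∑ x, P x * relEnt (W x) (W x0)) /
          Real.sqrt (2⁻¹ * ∑ y, (outDist P W y - W x0 y) ^ 2 / W x0 y)} Lr := by
  classical
  obtain ⟨x1, hx1⟩ := hX
  have hS : IsCompact {P : X → ℝ | IsDist P ∧ P x0 = 0} := isCompact_setOf_isDist_off
  have hpoint : ∀ φ : X → ℝ, ∑ x, (Pi.single x1 1 : X → ℝ) x * φ x = φ x1 := by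
    intro φ
    simp [Pi.single_apply]
  have hS1 : (Pi.single x1 1 : X → ℝ) ∈ {P : X → ℝ | IsDist P ∧ P x0 = 0} := by
    refine ⟨⟨fun x => ?_, by simp⟩, by simp [hx1.symm]⟩
    rw [Pi.single_apply]
    split_ifs <;> norm_num
  have hχpos : ∀ P : X → ℝ, IsDist P → P x0 = 0 → 0 < halfChiSq W x0 P :=
    fun P hP hP0 => halfChiSq_pos hsupp hnotred hP hP0
  set r : (X → ℝ) → ℝ := fun P => (∑ x, P x * relEnt (W x) (W x0)) /
    Real.sqrt (halfChiSq W x0 P) with hr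
  have hcont : ContinuousOn r {P : X → ℝ | IsDist P ∧ P x0 = 0} := by
    refine ContinuousOn.div (by fun_prop) continuous_halfChiSq.sqrt.continuousOn ?_
    exact fun P hP => (Real.sqrt_pos.2 (hχpos P hP.1 hP.2)).ne'
  obtain ⟨P, hP, hmax⟩ := hS.exists_isMaxOn ⟨_, hS1⟩ hcont
  obtain ⟨P₂, hP₂, hmin⟩ := hS.exists_isMinOn ⟨_, hS1⟩
    (continuous_halfChiSq (W := W) (x0 := x0)).continuousOn
  have hsqrt := Real.sqrt_pos.2 (hχpos P hP.1 hP.2)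
  have hrpos : 0 < r P := by
    refine lt_of_lt_of_le ?_ (hmax hS1)
    refine div_pos ?_ (Real.sqrt_pos.2 (hχpos _ hS1.1 hS1.2))
    rw [hpoint fun x => relEnt (W x) (W x0)]
    refine relEnt_pos (hW x1) (hW x0) hsupp fun h => hnotred ?_
    exact subset_convexHull ℝ _ ⟨x1, hx1, h⟩
  have hN : 0 < ∑ x, P x * relEnt (W x) (W x0) := (div_pos_iff_of_pos_right hsqrt).1 hrpos
  obtain ⟨K, hK, hconv⟩ := exists_log_card_le hW hsupp hrpos.le (hχpos P₂ hP₂.1 hP₂.2) hδ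
    (fun Q hQ hQ0 => hmin ⟨hQ, hQ0⟩)
    (fun Q hQ hQ0 => (div_le_iff₀ (Real.sqrt_pos.2 (hχpos Q hQ hQ0))).1 (hmax ⟨hQ, hQ0⟩))
  have hlt1 : ∀ᶠ ε : ℝ in 𝓝[>] 0, ε < 1 := nhdsWithin_le_nhds (eventually_lt_nhds one_pos)
  have hupper : L ≤ (r P : EReal) := by
    have hlim : Tendsto (fun ε : ℝ => r P / (1 - ε)) (𝓝[>] 0) (𝓝 (r P)) := by
      have h : ContinuousAt (fun ε : ℝ => r P / (1 - ε)) 0 :=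
        ContinuousAt.div (by fun_prop) (by fun_prop) (by norm_num)
      simpa using h.tendsto.mono_left nhdsWithin_le_nhds
    refine le_of_tendsto_of_tendsto hL ((continuous_coe_real_ereal.tendsto _).comp hlim) ?_
    filter_upwards [hlt1] with ε hε
    exact liminf_Kmax_le hrpos.le hK hδ hε hconv
  have hlower : (r P : EReal) ≤ L := by
    have hθ : ∀ θ : ℝ, 0 < θ → θ < 1 → ((θ ^ 3 * r P : ℝ) : EReal) ≤ L := by
      intro θ hθ0 hθ1
      refine ge_of_tendsto hL ?_
      filter_upwards [hlt1, self_mem_nhdsWithin] with ε hε hε0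
      obtain ⟨B, hB⟩ := exists_good_codes hW hsupp hP.1 hN (hχpos P hP.1 hP.2) hδ hε0 hθ0 hθ1
      exact le_liminf_Kmax hδ hε hconv hB
    have hlim : Tendsto (fun θ : ℝ => θ ^ 3 * r P) (𝓝[<] 1) (𝓝 (r P)) := by
      have h : ContinuousAt (fun θ : ℝ => θ ^ 3 * r P) 1 := by fun_prop
      simpa using h.tendsto.mono_left nhdsWithin_le_nhds
    refine le_of_tendsto ((continuous_coe_real_ereal.tendsto _).comp hlim) ?_
    filter_upwards [self_mem_nhdsWithin,
      nhdsWithin_le_nhds (eventually_gt_nhds (zero_lt_one (α := ℝ)))] with θ hθ1 hθ0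
    exact hθ θ hθ0 hθ1
  refine ⟨r P, hrpos, le_antisymm hupper hlower, ⟨P, hP.1, hP.2, rfl⟩, ?_⟩
  rintro _ ⟨Q, hQ, hQ0, rfl⟩
  exact hmax ⟨hQ, hQ0⟩
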